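/- arXiv:1912.05516 — 5 statements merged into one kernel-verified Lean document; each statement's English description precedes it below -/
import Mathlib

section
/- Let α > 0, σ ∈ (0,1), c > −σ, and let N ≥ 1 be an integer. Define λ_M := α · (Γ(c+1)/Γ(c+σ)) · Σ_{m=1}^{M} Γ(c+σ+N+m-1)/Γ(c+N+m) for integers M ≥ 1. Then λ_M / M^σ converges to ξ := (α/σ) · Γ(c+1)/Γ(c+σ) as M → ∞. -/
open Real Finset Filter

lemma aux_upper {x σ : ℝ} (hx : 0 < x) (h0 : 0 < σ) (h1 : σ < 1) :
    Real.Gamma (x + σ) ≤ Real.Gamma x * x ^ σ := by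
  have h := Real.Gamma_mul_add_mul_le_rpow_Gamma_mul_rpow_Gamma (s := x) (t := x + 1)
    (a := 1 - σ) (b := σ) hx (by linarith) (by linarith) h0 (by ring)
  have hG := Real.Gamma_pos_of_pos hx
  rw [show (1 - σ) * x + σ * (x + 1) = x + σ by ring, Real.Gamma_add_one hx.ne',
    Real.mul_rpow hx.le hG.le] at h
  calc _ ≤ _ := h
    _ = (Real.Gamma x ^ (1 - σ) * Real.Gamma x ^ σ) * x ^ σ := by ring
    _ = _ := by rw [← Real.rpow_add hG]; simp

lemma aux_lower {x σ : ℝ} (hx : 0 < x) (h0 : 0 < σ) (h1 : σ < 1) :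
    Real.Gamma x * (x * (x + σ) ^ (σ - 1)) ≤ Real.Gamma (x + σ) := by
  have hy : 0 < x + σ := by linarith
  have h := aux_upper hy (σ := 1 - σ) (by linarith) (by linarith)
  rw [show x + σ + (1 - σ) = x + 1 by ring, Real.Gamma_add_one hx.ne'] at h
  have hp : 0 < (x + σ) ^ (σ - 1) := Real.rpow_pos_of_pos hy _
  calc _ = (x * Real.Gamma x) * (x + σ) ^ (σ - 1) := by ring
    _ ≤ (Real.Gamma (x + σ) * (x + σ) ^ (1 - σ)) * (x + σ) ^ (σ - 1) := by gcongr
    _ = Real.Gamma (x + σ) * ((x + σ) ^ (1 - σ) * (x + σ) ^ (σ - 1)) := by ring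
    _ = _ := by rw [← Real.rpow_add hy]; simp

lemma aux_div (b : ℝ) : Tendsto (fun M : ℕ => (b + M) / (M : ℝ)) atTop (nhds 1) := by
  have h : Tendsto (fun M : ℕ => b / (M : ℝ) + 1) atTop (nhds (0 + 1)) :=
    (tendsto_const_div_atTop_nhds_zero_nat b).add_const 1
  rw [zero_add] at h
  refine h.congr' ?_
  filter_upwards [eventually_gt_atTop 0] with M hM
  have : (M : ℝ) ≠ 0 := by positivity
  field_simp

lemma aux_lim {b σ : ℝ} (hb : 0 < b) (h0 : 0 < σ) (h1 : σ < 1) :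
    Tendsto (fun M : ℕ => Real.Gamma (b + M + σ) / Real.Gamma (b + M) / (M : ℝ) ^ σ)
      atTop (nhds 1) := by
  have hu : Tendsto (fun M : ℕ => ((b + M) / (M : ℝ)) ^ σ) atTop (nhds 1) := by
    simpa using (aux_div b).rpow_const (p := σ) (Or.inl one_ne_zero)
  have hl : Tendsto (fun M : ℕ => ((b + M) / (M : ℝ)) * (((b + σ) + M) / (M : ℝ)) ^ (σ - 1))
      atTop (nhds 1) := by
    simpa using (aux_div b).mul
      ((aux_div (b + σ)).rpow_const (p := σ - 1) (Or.inl one_ne_zero))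
  refine tendsto_of_tendsto_of_tendsto_of_le_of_le' hl hu ?_ ?_
  · filter_upwards [eventually_gt_atTop 0] with M hM
    have hM' : (0 : ℝ) < M := by positivity
    have hx : 0 < b + M := by positivity
    have hG := Real.Gamma_pos_of_pos hx
    have h := aux_lower hx h0 h1
    have hp : 0 < (M : ℝ) ^ σ := Real.rpow_pos_of_pos hM' _
    rw [le_div_iff₀ hp, le_div_iff₀ hG]
    refine le_trans (le_of_eq ?_) h
    rw [show b + σ + M = b + M + σ by ring, Real.div_rpow (by positivity) hM'.le,
      Real.rpow_sub_one hM'.ne']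
    field_simp
  · filter_upwards [eventually_gt_atTop 0] with M hM
    have hM' : (0 : ℝ) < M := by positivity
    have hx : 0 < b + M := by positivity
    have hG := Real.Gamma_pos_of_pos hx
    have h := aux_upper hx h0 h1
    have hp : 0 < (M : ℝ) ^ σ := Real.rpow_pos_of_pos hM' _
    rw [Real.div_rpow hx.le hM'.le]
    gcongr
    rw [div_le_iff₀ hG]
    linarith

lemma aux_sum {b σ : ℝ} (hb : 0 < b) (h0 : 0 < σ) (M : ℕ) :
    ∑ m ∈ Finset.Icc 1 M, Real.Gamma (b + σ + m - 1) / Real.Gamma (b + m) =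
      (Real.Gamma (b + M + σ) / Real.Gamma (b + M) - Real.Gamma (b + σ) / Real.Gamma b) / σ := by
  induction M with
  | zero => simp
  | succ M ih =>
    rw [Finset.sum_Icc_succ_top (by omega), ih]
    have hx : 0 < b + M := by positivity
    have hG := Real.Gamma_pos_of_pos hx
    have hxs : 0 < b + M + σ := by positivity
    push_cast
    rw [show b + σ + ((M : ℝ) + 1) - 1 = b + M + σ by ring,
      show b + ((M : ℝ) + 1) + σ = (b + M + σ) + 1 by ring,
      show b + ((M : ℝ) + 1) = (b + M) + 1 by ring,
      Real.Gamma_add_one hx.ne', Real.Gamma_add_one hxs.ne']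
    have hGb := Real.Gamma_pos_of_pos hb
    field_simp
    ring

/-- For `α > 0`, `σ ∈ (0,1)`, `c > −σ`, `N ≥ 1`, the posterior predictive Poisson
mean `λ_M := α · (Γ(c+1)/Γ(c+σ)) · ∑_{m=1}^{M} Γ(c+σ+N+m-1)/Γ(c+N+m)` satisfies
`λ_M / M^σ → ξ := (α/σ) · Γ(c+1)/Γ(c+σ)` as `M → ∞`. -/
theorem stmt3 (α σ c : ℝ) (hα : 0 < α) (hσ0 : 0 < σ) (hσ1 : σ < 1) (hc : -σ < c)
    (N : ℕ) (hN : 1 ≤ N) :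
    Filter.Tendsto
      (fun M : ℕ =>
        (α * (Real.Gamma (c + 1) / Real.Gamma (c + σ)) *
            ∑ m ∈ Finset.Icc 1 M,
              Real.Gamma (c + σ + N + m - 1) / Real.Gamma (c + N + m)) / (M : ℝ) ^ σ)
      Filter.atTop
      (nhds (α / σ * (Real.Gamma (c + 1) / Real.Gamma (c + σ)))) := by
  have hN' : (1 : ℝ) ≤ N := by exact_mod_cast hN
  have hb : 0 < c + N := by linarith
  have hpow : Tendsto (fun M : ℕ => (M : ℝ) ^ σ) atTop atTop :=
    (tendsto_rpow_atTop hσ0).comp tendsto_natCast_atTop_atTop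
  have h2 := hpow.const_div_atTop (Real.Gamma (c + N + σ) / Real.Gamma (c + N))
  have h3 := ((aux_lim hb hσ0 hσ1).sub h2).const_mul
    (α / σ * (Real.Gamma (c + 1) / Real.Gamma (c + σ)))
  rw [sub_zero, mul_one] at h3
  refine h3.congr fun M => ?_
  rw [show c + σ + (N : ℝ) = c + N + σ by ring, aux_sum hb hσ0 M]
  ring
end

section
/- Let α > 0, σ ∈ (0,1), c > −σ, and let N ≥ 1 be an integer. For each integer M ≥ 1, set λ_M := α · (Γ(c+1)/Γ(c+σ)) · Σ_{m=1}^{M} Γ(c+σ+N+m−1)/Γ(c+N+m), let X_M be a random variable with Poisson distribution of mean λ_M, and set ξ := (α/σ) · Γ(c+1)/Γ(c+σ). Then the law of (X_M − ξ M^σ)/M^{σ/2} converges weakly, as M → ∞, to the Gaussian distribution on ℝ with mean 0 and variance ξ. -/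
open Real MeasureTheory ProbabilityTheory Filter Finset

lemma aux_gamma_bounds {x σ : ℝ} (hx : 0 < x) (h0 : 0 < σ) (h1 : σ < 1) :
    x ^ σ - 1 ≤ Real.Gamma (x + σ) / Real.Gamma x ∧
      Real.Gamma (x + σ) / Real.Gamma x ≤ x ^ σ := by
  have hG : 0 < Real.Gamma x := Real.Gamma_pos_of_pos hx
  have hGs : 0 < Real.Gamma (x + σ) := Real.Gamma_pos_of_pos (by linarith)
  constructor
  · have h := Real.Gamma_mul_add_mul_le_rpow_Gamma_mul_rpow_Gamma (s := x + σ) (t := x + σ + 1)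
      (a := σ) (b := 1 - σ) (by linarith) (by linarith) h0 (by linarith) (by ring)
    rw [show σ * (x + σ) + (1 - σ) * (x + σ + 1) = x + 1 by ring,
      Real.Gamma_add_one hx.ne', Real.Gamma_add_one (by linarith : x + σ ≠ 0),
      Real.mul_rpow (by linarith) hGs.le] at h
    have e1 : Real.Gamma (x + σ) ^ σ * ((x + σ) ^ (1 - σ) * Real.Gamma (x + σ) ^ (1 - σ))
        = Real.Gamma (x + σ) * (x + σ) ^ (1 - σ) := by
      have : Real.Gamma (x + σ) ^ σ * Real.Gamma (x + σ) ^ (1 - σ) = Real.Gamma (x + σ) := by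
        rw [← Real.rpow_add hGs]; simp
      calc _ = (Real.Gamma (x + σ) ^ σ * Real.Gamma (x + σ) ^ (1 - σ)) * (x + σ) ^ (1 - σ) := by
            ring
        _ = _ := by rw [this]
    rw [e1] at h
    have h2 : x / (x + 1) ^ (1 - σ) ≤ Real.Gamma (x + σ) / Real.Gamma x := by
      rw [div_le_div_iff₀ (by positivity) hG]
      refine h.trans ?_
      gcongr
    refine le_trans ?_ h2
    have hp : (0 : ℝ) < (x + 1) ^ (1 - σ) := by positivity
    have h3 : (x + 1) ^ σ * (x + 1) ^ (1 - σ) = x + 1 := by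
      rw [← Real.rpow_add (by linarith)]; simp
    have h4 : (1 : ℝ) ≤ (x + 1) ^ (1 - σ) := Real.one_le_rpow (by linarith) (by linarith)
    have h5 : x ^ σ ≤ (x + 1) ^ σ := by gcongr; linarith
    rw [le_div_iff₀ hp]
    nlinarith
  · have h := Real.Gamma_mul_add_mul_le_rpow_Gamma_mul_rpow_Gamma (s := x) (t := x + 1)
      (a := 1 - σ) (b := σ) hx (by linarith) (by linarith) h0 (by ring)
    rw [show (1 - σ) * x + σ * (x + 1) = x + σ by ring,
      Real.Gamma_add_one hx.ne', Real.mul_rpow hx.le hG.le] at h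
    rw [div_le_iff₀ hG]
    have : Real.Gamma x ^ (1 - σ) * Real.Gamma x ^ σ = Real.Gamma x := by
      rw [← Real.rpow_add hG]; simp
    calc _ ≤ _ := h
      _ = x ^ σ * (Real.Gamma x ^ (1 - σ) * Real.Gamma x ^ σ) := by ring
      _ = _ := by rw [this]

lemma aux_telescope {σ k : ℝ} (h0 : 0 < σ) (hk : 0 < k) (M : ℕ) :
    ∑ m ∈ Finset.Icc 1 M, Real.Gamma (k + σ + m - 1) / Real.Gamma (k + m)
      = (Real.Gamma (k + M + σ) / Real.Gamma (k + M) - Real.Gamma (k + σ) / Real.Gamma k) / σ := by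
  induction M with
  | zero => simp
  | succ M ih =>
    rw [Finset.sum_Icc_succ_top (by omega), ih]
    push_cast
    have hx : 0 < k + M := by positivity
    have hG := Real.Gamma_pos_of_pos hx
    rw [show k + σ + (M + 1 : ℝ) - 1 = k + M + σ by ring,
      show k + (M + 1 : ℝ) + σ = (k + M + σ) + 1 by ring,
      show k + (M + 1 : ℝ) = (k + M) + 1 by ring,
      Real.Gamma_add_one hx.ne', Real.Gamma_add_one (by positivity)]
    field_simp
    ring

lemma aux_mean {σ k : ℝ} (h0 : 0 < σ) (h1 : σ < 1) (hk : 0 < k) :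
    ∃ C : ℝ, ∀ M : ℕ,
      |(Real.Gamma (k + M + σ) / Real.Gamma (k + M) - Real.Gamma (k + σ) / Real.Gamma k)
        - (M : ℝ) ^ σ| ≤ C := by
  refine ⟨k ^ σ + 1 + |Real.Gamma (k + σ) / Real.Gamma k|, fun M => ?_⟩
  obtain ⟨ha, hb⟩ := aux_gamma_bounds (x := k + M) (by positivity) h0 h1
  have h2 : (k + M) ^ σ ≤ k ^ σ + (M : ℝ) ^ σ :=
    Real.rpow_add_le_add_rpow hk.le (by positivity) h0.le h1.le
  have h3 : (M : ℝ) ^ σ ≤ (k + M) ^ σ := by gcongr; linarith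
  have h4 : 0 < k ^ σ := by positivity
  have := abs_le.1 (le_refl |Real.Gamma (k + σ) / Real.Gamma k|)
  rw [abs_le]
  constructor <;> linarith [this.1, this.2]

lemma aux_charFun (r : NNReal) (b s t : ℝ) :
    charFun (Measure.map (fun k : ℕ => ((k : ℝ) - b) / s) (poissonMeasure r)) t
      = Complex.exp ((r : ℂ) * (Complex.exp ((t / s : ℝ) * Complex.I) - 1)
          - (t / s : ℝ) * Complex.I * b) := by
  have h := charFun_map_cast_poissonMeasure r (t / s)
  rw [charFun_apply, integral_map .of_discrete (by fun_prop)] at h ⊢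
  rw [Complex.exp_sub, ← h, ← integral_div]
  congr 1
  ext k
  rw [← Complex.exp_sub]
  congr 1
  simp only [Real.inner_apply]
  push_cast
  ring

lemma aux_limit {s e : ℕ → ℝ} (hs : Tendsto s atTop atTop) {C : ℝ} (he : ∀ n, |e n| ≤ C)
    (ξ t : ℝ) :
    Tendsto (fun n => ((ξ * s n ^ 2 + e n : ℝ) : ℂ) *
        (Complex.exp ((t / s n : ℝ) * Complex.I) - 1)
          - (t / s n : ℝ) * Complex.I * (ξ * s n ^ 2 : ℝ)) atTop
      (nhds (-(ξ : ℂ) * t ^ 2 / 2)) := by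
  have hu : Tendsto (fun n => t / s n) atTop (nhds 0) := hs.const_div_atTop t
  have hz : Tendsto (fun n => Complex.exp ((t / s n : ℝ) * Complex.I) - 1) atTop (nhds 0) := by
    have hc : Continuous (fun u : ℝ => Complex.exp ((u : ℂ) * Complex.I) - 1) := by fun_prop
    have := (hc.tendsto 0).comp hu
    simpa [Function.comp_def] using this
  have h1 : Tendsto (fun n => ((e n : ℝ) : ℂ) *
      (Complex.exp ((t / s n : ℝ) * Complex.I) - 1)) atTop (nhds 0) := by
    have hn := hz.norm.const_mul C
    rw [norm_zero, mul_zero] at hn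
    refine squeeze_zero_norm (fun n => ?_) hn
    rw [norm_mul, Complex.norm_real]
    gcongr
    exact he n
  have h2 : Tendsto (fun n => ((s n ^ 2 : ℝ) : ℂ) *
      (Complex.exp ((t / s n : ℝ) * Complex.I) -
        ∑ m ∈ Finset.range 3, ((t / s n : ℝ) * Complex.I) ^ m / (m.factorial : ℂ)))
      atTop (nhds 0) := by
    have hb : Tendsto (fun n => t ^ 2 * (|t / s n| * Real.exp |t / s n|)) atTop (nhds 0) := by
      have hc : Continuous (fun u : ℝ => t ^ 2 * (|u| * Real.exp |u|)) := by fun_prop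
      have := (hc.tendsto 0).comp hu
      simpa [Function.comp_def] using this
    refine squeeze_zero_norm' ?_ hb
    filter_upwards [hs.eventually_gt_atTop 0] with n hn
    have h := Complex.norm_exp_sub_sum_le_norm_mul_exp ((t / s n : ℝ) * Complex.I) 3
    have hno : ‖((t / s n : ℝ) * Complex.I : ℂ)‖ = |t / s n| := by
      rw [norm_mul, Complex.norm_real, Complex.norm_I, mul_one, Real.norm_eq_abs]
    rw [hno] at h
    rw [norm_mul, Complex.norm_real, Real.norm_of_nonneg (by positivity)]
    calc _ ≤ s n ^ 2 * (|t / s n| ^ 3 * Real.exp |t / s n|) := by gcongr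
      _ = (s n ^ 2 * |t / s n| ^ 2) * (|t / s n| * Real.exp |t / s n|) := by ring
      _ = _ := by
        rw [sq_abs]
        congr 1
        field_simp
  have h3 := ((h2.const_mul (ξ : ℂ)).add h1).add_const (-(ξ : ℂ) * t ^ 2 / 2)
  rw [mul_zero, add_zero, zero_add] at h3
  refine h3.congr' ?_
  filter_upwards [hs.eventually_gt_atTop 0] with n hn
  have hn' : (s n : ℂ) ≠ 0 := by exact_mod_cast hn.ne'
  simp only [Finset.sum_range_succ, Finset.sum_range_zero, Nat.factorial]
  push_cast
  generalize Complex.exp (t / s n * Complex.I) = E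
  field_simp
  rw [Complex.I_sq]
  ring

/-- Posterior predictive central limit theorem.  Let
`λ_M := α (Γ(c+1)/Γ(c+σ)) ∑_{m=1}^M Γ(c+σ+N+m−1)/Γ(c+N+m)` and
`ξ := (α/σ) Γ(c+1)/Γ(c+σ)`.  If `X_M ~ Poisson(λ_M)`, then the law of
`(X_M − ξ M^σ)/M^{σ/2}` converges weakly to the Gaussian `N(0, ξ)`.  The law of the
normalized variable is encoded as the pushforward of the Poisson measure under
`k ↦ ((k:ℝ) − ξ M^σ)/M^{σ/2}`. -/
theorem stmt6 (α σ c : ℝ) (hα : 0 < α) (hσ0 : 0 < σ) (hσ1 : σ < 1) (hc : -σ < c)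
    (N : ℕ) (hN : 1 ≤ N)
    (μ : ℕ → ProbabilityMeasure ℝ)
    (hμ : ∀ M : ℕ, 1 ≤ M →
      (μ M : Measure ℝ) =
        Measure.map
          (fun k : ℕ =>
            ((k : ℝ) - α / σ * (Real.Gamma (c + 1) / Real.Gamma (c + σ)) * (M : ℝ) ^ σ) /
              (M : ℝ) ^ (σ / 2))
          (poissonMeasure
            (Real.toNNReal
              (α * (Real.Gamma (c + 1) / Real.Gamma (c + σ)) *
                ∑ m ∈ Finset.Icc 1 M,
                  Real.Gamma (c + σ + N + m - 1) / Real.Gamma (c + N + m)))))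
    (ν : ProbabilityMeasure ℝ)
    (hν : (ν : Measure ℝ) =
      gaussianReal 0 (Real.toNNReal (α / σ * (Real.Gamma (c + 1) / Real.Gamma (c + σ))))) :
    Filter.Tendsto μ Filter.atTop (nhds ν) := by
  have hc1 : 0 < c + σ := by linarith
  have hN' : (1 : ℝ) ≤ N := by exact_mod_cast hN
  have hk : 0 < c + N := by linarith
  have hA : 0 < Real.Gamma (c + 1) / Real.Gamma (c + σ) :=
    div_pos (Real.Gamma_pos_of_pos (by linarith)) (Real.Gamma_pos_of_pos hc1)
  obtain ⟨C, hC⟩ := aux_mean hσ0 hσ1 hk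
  generalize Real.Gamma (c + 1) / Real.Gamma (c + σ) = A at *
  have hξ : 0 < α / σ * A := by positivity
  have hs : Tendsto (fun M : ℕ => (M : ℝ) ^ (σ / 2)) atTop atTop :=
    (tendsto_rpow_atTop (by linarith)).comp tendsto_natCast_atTop_atTop
  have hs2 : ∀ M : ℕ, ((M : ℝ) ^ (σ / 2)) ^ 2 = (M : ℝ) ^ σ := fun M => by
    rw [← Real.rpow_natCast, ← Real.rpow_mul (by positivity)]
    congr 1
    push_cast
    ring
  rw [ProbabilityMeasure.tendsto_iff_tendsto_charFun]
  intro t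
  rw [hν, charFun_gaussianReal]
  have hL := aux_limit hs (C := α / σ * A * C)
    (e := fun M : ℕ => α / σ * A *
      ((Real.Gamma (c + N + M + σ) / Real.Gamma (c + N + M)
        - Real.Gamma (c + N + σ) / Real.Gamma (c + N)) - (M : ℝ) ^ σ))
    (fun M => by
      rw [abs_mul, abs_of_pos hξ]
      exact mul_le_mul_of_nonneg_left (hC M) hξ.le) (α / σ * A) t
  have hE := (Complex.continuous_exp.tendsto _).comp hL
  have hlim : Complex.exp (-((α / σ * A : ℝ) : ℂ) * t ^ 2 / 2) =
      Complex.exp (t * (0 : ℝ) * Complex.I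
        - ((Real.toNNReal (α / σ * A) : NNReal) : ℝ) * t ^ 2 / 2) := by
    rw [Real.coe_toNNReal _ hξ.le]
    congr 1
    push_cast
    ring
  rw [hlim] at hE
  refine hE.congr' ?_
  filter_upwards [eventually_ge_atTop 1] with M hM
  rw [hμ M hM, aux_charFun, Function.comp_apply]
  have hsum : ∑ m ∈ Finset.Icc 1 M, Real.Gamma (c + σ + N + m - 1) / Real.Gamma (c + N + m)
      = (Real.Gamma (c + N + M + σ) / Real.Gamma (c + N + M)
        - Real.Gamma (c + N + σ) / Real.Gamma (c + N)) / σ := by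
    rw [← aux_telescope hσ0 hk]
    refine Finset.sum_congr rfl fun m _ => ?_
    rw [show c + σ + N + m - 1 = c + N + σ + m - 1 by ring]
  have hpos : 0 ≤ ∑ m ∈ Finset.Icc 1 M,
      Real.Gamma (c + σ + N + m - 1) / Real.Gamma (c + N + m) := by
    refine Finset.sum_nonneg fun m hm => ?_
    have hm1 : (1 : ℝ) ≤ m := by exact_mod_cast (Finset.mem_Icc.1 hm).1
    exact div_nonneg (Real.Gamma_pos_of_pos (by linarith)).le
      (Real.Gamma_pos_of_pos (by linarith)).le
  have hr : ((Real.toNNReal (α * A * ∑ m ∈ Finset.Icc 1 M,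
      Real.Gamma (c + σ + N + m - 1) / Real.Gamma (c + N + m)) : NNReal) : ℝ) =
      α / σ * A * ((M : ℝ) ^ (σ / 2)) ^ 2 + α / σ * A *
      ((Real.Gamma (c + N + M + σ) / Real.Gamma (c + N + M)
        - Real.Gamma (c + N + σ) / Real.Gamma (c + N)) - (M : ℝ) ^ σ) := by
    rw [Real.coe_toNNReal _ (by positivity), hsum, hs2]
    ring
  rw [← hr, hs2]
end

section
/- Let α > 0, σ ∈ (0,1), c > −σ, and let N ≥ 1 and r ≥ 1 be fixed integers. For integers M ≥ r, define λ_r(M) := α · binom(M,r) · Γ(r−σ) Γ(c+σ+N+M−r) Γ(c+1) / (Γ(1−σ) Γ(c+σ) Γ(c+N+M)). Then λ_r(M)/M^σ converges, as M → ∞, to ξ_r := (α/r!) · (Γ(r−σ)/Γ(1−σ)) · Γ(c+1)/Γ(c+σ). -/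
open Real Filter

lemma gamma_add_nat_prod (s : ℝ) (hs : 0 < s) (n : ℕ) :
    Real.Gamma (s + n) = Real.Gamma s * ∏ j ∈ Finset.range n, (s + j) := by
  induction n with
  | zero => simp
  | succ n ih =>
    have h : s + (n : ℝ) ≠ 0 := by positivity
    rw [Finset.prod_range_succ, ← mul_assoc, ← ih]
    push_cast
    rw [← add_assoc, Real.Gamma_add_one h]
    ring

lemma gamma_ratio_base (s : ℝ) (hs : 0 < s) :
    Tendsto (fun M : ℕ => Real.Gamma (s + 1 + M) / ((M.factorial : ℝ) * (M : ℝ) ^ s))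
      atTop (nhds 1) := by
  have hG : Real.Gamma s ≠ 0 := (Real.Gamma_pos_of_pos hs).ne'
  have h := (Real.GammaSeq_tendsto_Gamma s).inv₀ hG |>.const_mul (Real.Gamma s)
  rw [mul_inv_cancel₀ hG] at h
  refine h.congr fun M => ?_
  have e := gamma_add_nat_prod s hs (M + 1)
  push_cast at e
  rw [show s + 1 + (M : ℝ) = s + (M + 1) by ring, e, Real.GammaSeq, inv_div, mul_div_assoc]
  congr 2
  ring

lemma gamma_ratio (k : ℕ) : ∀ x : ℝ, 1 < x + k →
    Tendsto (fun M : ℕ => Real.Gamma (x + M) / ((M.factorial : ℝ) * (M : ℝ) ^ (x - 1)))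
      atTop (nhds 1) := by
  induction k with
  | zero =>
    intro x hx
    have := gamma_ratio_base (x - 1) (by simp at hx; linarith)
    simpa using this
  | succ k ih =>
    intro x hx
    have h1 := ih (x + 1) (by push_cast at hx; linarith)
    have h2 := (tendsto_natCast_div_add_atTop x).mul h1
    rw [one_mul] at h2
    refine h2.congr' ?_
    filter_upwards [eventually_gt_atTop ⌈|x|⌉₊] with M hM
    have hM1 : |x| < M := Nat.lt_of_ceil_lt hM
    have hM0 : (0 : ℝ) < M := (abs_nonneg x).trans_lt hM1
    have hx0 : (M : ℝ) + x ≠ 0 := by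
      have := neg_abs_le x
      intro h
      linarith
    have hg : Real.Gamma (x + 1 + M) = (M + x) * Real.Gamma (x + M) := by
      rw [show x + 1 + (M : ℝ) = (x + M) + 1 by ring, Real.Gamma_add_one (by rwa [add_comm])]
      ring
    have hp : (M : ℝ) ^ (x + 1 - 1) = (M : ℝ) ^ (x - 1) * M := by
      rw [← Real.rpow_add_one hM0.ne']
      congr 1
      ring
    have hq : (M : ℝ) ^ (x - 1) ≠ 0 := (Real.rpow_pos_of_pos hM0 _).ne'
    have hf : (M.factorial : ℝ) ≠ 0 := by positivity
    rw [hg, hp]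
    field_simp

lemma gamma_ratio' (x : ℝ) :
    Tendsto (fun M : ℕ => Real.Gamma (x + M) / ((M.factorial : ℝ) * (M : ℝ) ^ (x - 1)))
      atTop (nhds 1) := by
  obtain ⟨k, hk⟩ := exists_nat_gt (1 - x)
  exact gamma_ratio k x (by linarith)

lemma choose_ratio (r : ℕ) :
    Tendsto (fun M : ℕ => (M.choose r : ℝ) / (M : ℝ) ^ r) atTop (nhds (1 / r.factorial)) := by
  have h := Asymptotics.IsEquivalent.div (isEquivalent_choose r)
    (Asymptotics.IsEquivalent.refl (u := fun M : ℕ => (M : ℝ) ^ r) (l := atTop))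
  refine (Asymptotics.IsEquivalent.tendsto_nhds_iff h).2 ?_
  refine tendsto_const_nhds.congr' ?_
  filter_upwards [eventually_gt_atTop 0] with M hM
  have : (0 : ℝ) < M := by exact_mod_cast hM
  simp only [Pi.div_apply]
  field_simp

/-- For fixed `N ≥ 1`, `r ≥ 1`, the posterior predictive Poisson mean
`λ_r(M) := α·C(M,r)·Γ(r−σ)Γ(c+σ+N+M−r)Γ(c+1)/(Γ(1−σ)Γ(c+σ)Γ(c+N+M))` satisfies
`λ_r(M)/M^σ → ξ_r := (α/r!)·(Γ(r−σ)/Γ(1−σ))·Γ(c+1)/Γ(c+σ)` as `M → ∞`. -/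
theorem stmt8 (α σ c : ℝ) (hα : 0 < α) (hσ0 : 0 < σ) (hσ1 : σ < 1) (hc : -σ < c)
    (N r : ℕ) (hN : 1 ≤ N) (hr : 1 ≤ r) :
    Filter.Tendsto
      (fun M : ℕ =>
        (α * (M.choose r : ℝ) *
            (Real.Gamma ((r : ℝ) - σ) * Real.Gamma (c + σ + N + M - r) * Real.Gamma (c + 1)) /
            (Real.Gamma (1 - σ) * Real.Gamma (c + σ) * Real.Gamma (c + N + M))) /
          (M : ℝ) ^ σ)
      Filter.atTop
      (nhds (α / (r.factorial : ℝ) * (Real.Gamma ((r : ℝ) - σ) / Real.Gamma (1 - σ)) *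
        (Real.Gamma (c + 1) / Real.Gamma (c + σ)))) := by
  have h1 := gamma_ratio' (c + σ + N - r)
  have h2 := gamma_ratio' (c + N)
  have h3 := choose_ratio r
  have h := ((h3.mul (h1.div h2 one_ne_zero)).const_mul
    (α * (Real.Gamma ((r : ℝ) - σ) / Real.Gamma (1 - σ)) *
        (Real.Gamma (c + 1) / Real.Gamma (c + σ))))
  have e : α / (r.factorial : ℝ) * (Real.Gamma ((r : ℝ) - σ) / Real.Gamma (1 - σ)) *
        (Real.Gamma (c + 1) / Real.Gamma (c + σ)) =
      (α * (Real.Gamma ((r : ℝ) - σ) / Real.Gamma (1 - σ)) *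
        (Real.Gamma (c + 1) / Real.Gamma (c + σ))) * (1 / r.factorial * (1 / 1)) := by
    ring
  rw [e]
  refine h.congr' ?_
  filter_upwards [eventually_gt_atTop 0] with M hM
  have hM0 : (0 : ℝ) < M := by exact_mod_cast hM
  have hf : (M.factorial : ℝ) ≠ 0 := by positivity
  have hN' : (1 : ℝ) ≤ N := by exact_mod_cast hN
  have g1 : Real.Gamma (1 - σ) ≠ 0 := (Real.Gamma_pos_of_pos (by linarith)).ne'
  have g2 : Real.Gamma (c + σ) ≠ 0 := (Real.Gamma_pos_of_pos (by linarith)).ne'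
  have g3 : Real.Gamma (c + N + M) ≠ 0 := (Real.Gamma_pos_of_pos (by linarith)).ne'
  have hp : (M : ℝ) ^ (c + N - 1) * (M : ℝ) ^ σ =
      (M : ℝ) ^ (c + σ + N - r - 1) * (M : ℝ) ^ r := by
    rw [← Real.rpow_natCast (M : ℝ) r, ← Real.rpow_add hM0, ← Real.rpow_add hM0]
    congr 1
    ring
  have q1 : (M : ℝ) ^ (c + N - 1) ≠ 0 := (Real.rpow_pos_of_pos hM0 _).ne'
  have q2 : (M : ℝ) ^ (c + σ + N - r - 1) ≠ 0 := (Real.rpow_pos_of_pos hM0 _).ne'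
  have q3 : (M : ℝ) ^ σ ≠ 0 := (Real.rpow_pos_of_pos hM0 _).ne'
  have q4 : (M : ℝ) ^ r ≠ 0 := by positivity
  simp only [Pi.div_apply]
  rw [show c + σ + N + (M : ℝ) - r = c + σ + N - r + M by ring]
  generalize (M : ℝ) ^ (c + N - 1) = A at *
  generalize (M : ℝ) ^ (c + σ + N - r - 1) = B at *
  generalize (M : ℝ) ^ σ = C at *
  generalize (M : ℝ) ^ r = D at *
  generalize Real.Gamma (c + σ + N - r + M) = G at *
  generalize Real.Gamma (c + N + M) = H at *
  generalize Real.Gamma (1 - σ) = K at *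
  generalize Real.Gamma (c + σ) = L at *
  have hA : A = B * D / C := by
    rw [← hp]
    field_simp
  subst hA
  field_simp
end

section
/- Let α > 0, σ ∈ (0,1), c > −σ, and let N ≥ 1 and r ≥ 1 be fixed integers. For each integer M ≥ r, let Y_M be a random variable with Poisson distribution of mean λ_r(M) := α · binom(M,r) · Γ(r−σ) Γ(c+σ+N+M−r) Γ(c+1) / (Γ(1−σ) Γ(c+σ) Γ(c+N+M)), and set ξ_r := (α/r!) · (Γ(r−σ)/Γ(1−σ)) · Γ(c+1)/Γ(c+σ). Then the law of (Y_M − ξ_r M^σ)/M^{σ/2} converges weakly, as M → ∞, to the Gaussian distribution on ℝ with mean 0 and variance ξ_r. -/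
open Real MeasureTheory ProbabilityTheory Filter

/-- `f = 1 + O(1/M)`. -/
def NearOne (f : ℕ → ℝ) : Prop :=
  (fun M : ℕ => f M - 1) =O[atTop] (fun M : ℕ => ((M : ℝ))⁻¹)

lemma NearOne.tendsto {f : ℕ → ℝ} (hf : NearOne f) : Tendsto f atTop (nhds 1) := by
  have h := Asymptotics.IsBigO.trans_tendsto hf
    (tendsto_inv_atTop_zero.comp (tendsto_natCast_atTop_atTop (R := ℝ)))
  simpa using h.add_const 1

lemma NearOne.mul {f g : ℕ → ℝ} (hf : NearOne f) (hg : NearOne g) :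
    NearOne (fun M => f M * g M) := by
  have h1 : (fun M => (f M - 1) * g M) =O[atTop] (fun M : ℕ => ((M : ℝ))⁻¹ * 1) :=
    Asymptotics.IsBigO.mul hf (hg.tendsto.isBigO_one ℝ)
  simp only [mul_one] at h1
  have h2 := h1.add hg
  refine h2.congr_left fun M => by ring

lemma NearOne.comp {f : ℕ → ℝ} (hf : NearOne f) {φ : ℝ → ℝ} {d : ℝ} (h : HasDerivAt φ d 1)
    (h1 : φ 1 = 1) : NearOne (fun M => φ (f M)) := by
  have h2 := (h.isBigO_sub.comp_tendsto hf.tendsto).trans hf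
  simpa [NearOne, Function.comp_def, h1] using h2

lemma NearOne.inv {f : ℕ → ℝ} (hf : NearOne f) : NearOne (fun M => (f M)⁻¹) :=
  hf.comp (hasDerivAt_inv one_ne_zero) (by simp)

lemma NearOne.rpow {f : ℕ → ℝ} (hf : NearOne f) (p : ℝ) : NearOne (fun M => (f M) ^ p) :=
  hf.comp (Real.hasDerivAt_rpow_const (p := p) (Or.inl one_ne_zero)) (by simp)

lemma NearOne.congr {f g : ℕ → ℝ} (hf : NearOne f) (h : ∀ᶠ M in atTop, f M = g M) :
    NearOne g := by
  refine Asymptotics.IsBigO.congr' hf ?_ EventuallyEq.rfl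
  filter_upwards [h] with M hM
  rw [hM]

lemma NearOne.squeeze {f g k : ℕ → ℝ} (hf : NearOne f) (hk : NearOne k)
    (h1 : ∀ᶠ M in atTop, f M ≤ g M) (h2 : ∀ᶠ M in atTop, g M ≤ k M) : NearOne g := by
  have h3 := (Asymptotics.IsBigO.norm_left hf).add (Asymptotics.IsBigO.norm_left hk)
  refine Asymptotics.IsBigO.trans ?_ h3
  refine Asymptotics.IsBigO.of_bound 1 ?_
  filter_upwards [h1, h2] with M a b
  rw [one_mul]
  simp only [Real.norm_eq_abs]
  rw [abs_of_nonneg (by positivity : 0 ≤ |f M - 1| + |k M - 1|)]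
  rw [abs_le]
  constructor
  · linarith [neg_abs_le (f M - 1), abs_nonneg (k M - 1)]
  · linarith [le_abs_self (k M - 1), abs_nonneg (f M - 1)]

lemma nearOne_lin (a : ℝ) : NearOne (fun M : ℕ => ((M : ℝ) + a) / M) := by
  have : (fun M : ℕ => a * ((M : ℝ))⁻¹) =O[atTop] (fun M : ℕ => ((M : ℝ))⁻¹) :=
    Asymptotics.isBigO_const_mul_self a _ _
  refine this.congr' ?_ EventuallyEq.rfl
  filter_upwards [eventually_gt_atTop 0] with M hM
  have : (M : ℝ) ≠ 0 := by positivity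
  field_simp
  ring

lemma gamma_upper {z σ : ℝ} (hz : 0 < z) (h0 : 0 < σ) (h1 : σ < 1) :
    Real.Gamma (z + σ) ≤ z ^ σ * Real.Gamma z := by
  have h := Real.Gamma_mul_add_mul_le_rpow_Gamma_mul_rpow_Gamma hz (by linarith : 0 < z + 1)
    (sub_pos.2 h1) h0 (by ring)
  have hG := Real.Gamma_pos_of_pos hz
  rw [Real.Gamma_add_one hz.ne', Real.mul_rpow hz.le hG.le] at h
  have e : Real.Gamma z ^ (1 - σ) * Real.Gamma z ^ σ = Real.Gamma z := by
    rw [← Real.rpow_add hG]; simp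
  have e2 : (1 - σ) * z + σ * (z + 1) = z + σ := by ring
  rw [e2] at h
  calc _ ≤ _ := h
    _ = z ^ σ * (Real.Gamma z ^ (1 - σ) * Real.Gamma z ^ σ) := by ring
    _ = _ := by rw [e]

lemma gamma_lower {z σ : ℝ} (hz : 0 < z) (h0 : 0 < σ) (h1 : σ < 1) :
    z * (z + σ) ^ (σ - 1) * Real.Gamma z ≤ Real.Gamma (z + σ) := by
  have hz' : 0 < z + σ := by linarith
  have h := gamma_upper hz' (sub_pos.2 h1) (by linarith : 1 - σ < 1)
  have e : z + σ + (1 - σ) = z + 1 := by ring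
  rw [e, Real.Gamma_add_one hz.ne'] at h
  have hp : 0 < (z + σ) ^ (σ - 1) := Real.rpow_pos_of_pos hz' _
  have e2 : (z + σ) ^ (σ - 1) * (z + σ) ^ (1 - σ) = 1 := by
    rw [← Real.rpow_add hz']; simp
  calc _ = (z + σ) ^ (σ - 1) * (z * Real.Gamma z) := by ring
    _ ≤ (z + σ) ^ (σ - 1) * ((z + σ) ^ (1 - σ) * Real.Gamma (z + σ)) := by gcongr
    _ = ((z + σ) ^ (σ - 1) * (z + σ) ^ (1 - σ)) * Real.Gamma (z + σ) := by ring
    _ = _ := by rw [e2, one_mul]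

lemma eventually_pos_add (a : ℝ) : ∀ᶠ M : ℕ in atTop, 0 < (M : ℝ) + a := by
  filter_upwards [(tendsto_natCast_atTop_atTop (R := ℝ)).eventually_gt_atTop (-a)] with M hM
  linarith

lemma nearOne_gamma (a σ : ℝ) (h0 : 0 < σ) (h1 : σ < 1) :
    NearOne (fun M : ℕ => Real.Gamma (M + a + σ) / Real.Gamma (M + a) / (M : ℝ) ^ σ) := by
  refine NearOne.squeeze ((nearOne_lin a).mul ((nearOne_lin (a + σ)).rpow (σ - 1)))
    ((nearOne_lin a).rpow σ) ?_ ?_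
  · filter_upwards [eventually_pos_add a, eventually_gt_atTop 0] with M hz hM
    have hM' : (0 : ℝ) < M := by positivity
    have hG := Real.Gamma_pos_of_pos hz
    have := gamma_lower hz h0 h1
    rw [Real.div_rpow (by linarith) hM'.le, le_div_iff₀ (by positivity), le_div_iff₀ hG]
    refine le_trans (le_of_eq ?_) this
    rw [Real.rpow_sub_one hM'.ne', ← add_assoc]
    have : (M : ℝ) ^ σ ≠ 0 := by positivity
    field_simp
  · filter_upwards [eventually_pos_add a, eventually_gt_atTop 0] with M hz hM
    have hM' : (0 : ℝ) < M := by positivity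
    have hG := Real.Gamma_pos_of_pos hz
    have := gamma_upper hz h0 h1
    rw [Real.div_rpow hz.le hM'.le]
    gcongr
    rwa [div_le_iff₀ hG]

lemma nearOne_ratio (a σ : ℝ) (h0 : 0 < σ) (h1 : σ < 1) (r : ℕ) :
    NearOne (fun M : ℕ => (M.descFactorial r : ℝ) *
      (Real.Gamma (M + a + σ - r) / Real.Gamma (M + a)) / (M : ℝ) ^ σ) := by
  induction r with
  | zero => simpa using nearOne_gamma a σ h0 h1
  | succ r ih =>
    refine NearOne.congr ((ih.mul (nearOne_lin (-r))).mul
      (nearOne_lin (a + σ - r - 1)).inv) ?_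
    filter_upwards [eventually_pos_add (a + σ - r - 1), eventually_ge_atTop (r + 1)] with M hz hM
    have hM' : (0 : ℝ) < M := by
      have : 0 < M := by omega
      positivity
    have e : (M : ℝ) + a + σ - r = (M + (a + σ - r - 1)) + 1 := by ring
    have e2 : (M : ℝ) + a + σ - ((r + 1 : ℕ) : ℝ) = (M + (a + σ - r - 1)) := by
      push_cast; ring
    rw [e, e2, Real.Gamma_add_one hz.ne', Nat.descFactorial_succ, Nat.cast_mul,
      Nat.cast_sub (by omega)]
    have := hz.ne'
    field_simp
    ring

lemma charFun_map_affine (P : Measure ℕ) (m s : ℝ) (hs : s ≠ 0) (t : ℝ) :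
    charFun (Measure.map (fun k : ℕ => ((k : ℝ) - m) / s) P) t =
      Complex.exp (-((t / s : ℝ) : ℂ) * m * Complex.I) *
        charFun (Measure.map (Nat.cast : ℕ → ℝ) P) (t / s) := by
  have hs' : (s : ℂ) ≠ 0 := by exact_mod_cast hs
  rw [charFun_apply_real, charFun_apply_real, integral_map .of_discrete (by fun_prop),
    integral_map .of_discrete (by fun_prop), ← integral_const_mul]
  congr 1
  ext k
  rw [← Complex.exp_add]
  congr 1
  push_cast
  field_simp
  ring

lemma poisson_clt (ξ : ℝ) (hξ : 0 ≤ ξ) (L s : ℕ → ℝ) (hL : ∀ᶠ M in atTop, 0 ≤ L M)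
    (hs : Tendsto s atTop atTop)
    (h : Tendsto (fun M => (L M - ξ * (s M) ^ 2) / s M) atTop (nhds 0))
    (μ : ℕ → ProbabilityMeasure ℝ)
    (hμ : ∀ᶠ M : ℕ in atTop, (μ M : Measure ℝ) =
      Measure.map (fun k : ℕ => ((k : ℝ) - ξ * (s M) ^ 2) / s M)
        (poissonMeasure (Real.toNNReal (L M))))
    (ν : ProbabilityMeasure ℝ)
    (hν : (ν : Measure ℝ) = gaussianReal 0 (Real.toNNReal ξ)) :
    Tendsto μ atTop (nhds ν) := by
  refine ProbabilityMeasure.tendsto_iff_tendsto_charFun.2 fun t => ?_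
  rw [hν, charFun_gaussianReal]
  have hs0 := hs.eventually_gt_atTop 0
  have hinv : Tendsto (fun M => (s M)⁻¹) atTop (nhds 0) := tendsto_inv_atTop_zero.comp hs
  have hu : Tendsto (fun M => ((t / s M : ℝ) : ℂ) * Complex.I) atTop (nhds 0) := by
    have h1 : Tendsto (fun M => t / s M) atTop (nhds 0) := by
      simpa [div_eq_mul_inv] using hinv.const_mul t
    have h2 := (Complex.continuous_ofReal.tendsto 0).comp h1
    simpa using h2.mul_const Complex.I
  have hLs : Tendsto (fun M => L M / (s M) ^ 2) atTop (nhds ξ) := by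
    have h1 := (h.mul hinv).add_const ξ
    simp only [mul_zero, zero_add] at h1
    refine h1.congr' ?_
    filter_upwards [hs0] with M hM
    field_simp
    ring
  have hquad : Tendsto (fun M => (L M : ℂ) * (((t / s M : ℝ) : ℂ) * Complex.I) ^ 2) atTop
      (nhds ((ξ : ℂ) * (-(t : ℂ) ^ 2))) := by
    have h1 := ((Complex.continuous_ofReal.tendsto ξ).comp hLs).mul_const (-(t : ℂ) ^ 2)
    refine h1.congr fun M => ?_
    simp only [Function.comp_apply, mul_pow, Complex.I_sq]
    push_cast
    ring
  have hrem : Tendsto (fun M => (L M : ℂ) * (Complex.exp (((t / s M : ℝ) : ℂ) * Complex.I)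
      - ∑ i ∈ Finset.range 3, (((t / s M : ℝ) : ℂ) * Complex.I) ^ i / (i.factorial : ℂ)))
      atTop (nhds 0) := by
    have h1 := (Complex.exp_sub_sum_range_succ_isLittleO_pow 2).comp_tendsto hu
    have h2 := (Asymptotics.isBigO_refl (fun M => (L M : ℂ)) atTop).mul_isLittleO h1
    have h3 := (h2.trans_isBigO (hquad.isBigO_one ℂ))
    exact (Asymptotics.isLittleO_one_iff ℂ).1 h3
  have hlin : Tendsto (fun M => (((L M - ξ * (s M) ^ 2) / s M : ℝ) : ℂ) * (t * Complex.I))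
      atTop (nhds 0) := by
    have h1 := (Complex.continuous_ofReal.tendsto 0).comp h
    simpa using h1.mul_const (t * Complex.I)
  have hall := ((hrem.add (hquad.div_const 2)).add hlin)
  have hexp := (Complex.continuous_exp.tendsto _).comp hall
  have etarget : Complex.exp ((t : ℂ) * ((0 : ℝ) : ℂ) * Complex.I
      - ((Real.toNNReal ξ : NNReal) : ℂ) * (t : ℂ) ^ 2 / 2)
      = Complex.exp (0 + ((ξ : ℂ) * (-(t : ℂ) ^ 2)) / 2 + 0) := by
    have : ((Real.toNNReal ξ : NNReal) : ℂ) = (ξ : ℂ) := by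
      have := Real.coe_toNNReal ξ hξ
      exact_mod_cast congrArg (fun x : ℝ => (x : ℂ)) this
    rw [this]
    congr 1
    simp
    ring
  rw [etarget]
  refine hexp.congr' ?_
  filter_upwards [hs0, hL, hμ] with M hM hLM hμM
  rw [hμM, charFun_map_affine _ _ _ hM.ne']
  rw [charFun_map_cast_poissonMeasure, ← Complex.exp_add]
  have e1 : ((Real.toNNReal (L M) : NNReal) : ℂ) = (L M : ℂ) := by
    have := Real.coe_toNNReal (L M) hLM
    exact_mod_cast congrArg (fun x : ℝ => (x : ℂ)) this
  rw [e1]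
  simp only [Function.comp_apply]
  congr 1
  simp only [Finset.sum_range_succ, Finset.sum_range_zero]
  have hM' : (s M : ℂ) ≠ 0 := by exact_mod_cast hM.ne'
  push_cast
  norm_num [Nat.factorial]
  field_simp
  ring

/-- CLT for the number of new variants appearing exactly `r` times.  With
`λ_r(M) := α·C(M,r)·Γ(r−σ)Γ(c+σ+N+M−r)Γ(c+1)/(Γ(1−σ)Γ(c+σ)Γ(c+N+M))` and
`ξ_r := (α/r!)·(Γ(r−σ)/Γ(1−σ))·Γ(c+1)/Γ(c+σ)`, if `Y_M ~ Poisson(λ_r(M))` then the law of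
`(Y_M − ξ_r M^σ)/M^{σ/2}` converges weakly to the Gaussian `N(0, ξ_r)`. -/
theorem stmt9 (α σ c : ℝ) (hα : 0 < α) (hσ0 : 0 < σ) (hσ1 : σ < 1) (hc : -σ < c)
    (N r : ℕ) (hN : 1 ≤ N) (hr : 1 ≤ r)
    (μ : ℕ → ProbabilityMeasure ℝ)
    (hμ : ∀ M : ℕ, r ≤ M →
      (μ M : Measure ℝ) =
        Measure.map
          (fun k : ℕ =>
            ((k : ℝ) -
                α / (r.factorial : ℝ) * (Real.Gamma ((r : ℝ) - σ) / Real.Gamma (1 - σ)) *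
                  (Real.Gamma (c + 1) / Real.Gamma (c + σ)) * (M : ℝ) ^ σ) /
              (M : ℝ) ^ (σ / 2))
          (poissonMeasure
            (Real.toNNReal
              (α * (M.choose r : ℝ) *
                  (Real.Gamma ((r : ℝ) - σ) * Real.Gamma (c + σ + N + M - r) *
                    Real.Gamma (c + 1)) /
                (Real.Gamma (1 - σ) * Real.Gamma (c + σ) * Real.Gamma (c + N + M))))))
    (ν : ProbabilityMeasure ℝ)
    (hν : (ν : Measure ℝ) =
      gaussianReal 0
        (Real.toNNReal
          (α / (r.factorial : ℝ) * (Real.Gamma ((r : ℝ) - σ) / Real.Gamma (1 - σ)) *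
            (Real.Gamma (c + 1) / Real.Gamma (c + σ))))) :
    Filter.Tendsto μ Filter.atTop (nhds ν) := by
  set ξ : ℝ := α / (r.factorial : ℝ) * (Real.Gamma ((r : ℝ) - σ) / Real.Gamma (1 - σ)) *
            (Real.Gamma (c + 1) / Real.Gamma (c + σ)) with hξdef
  have hr' : (1 : ℝ) ≤ r := by exact_mod_cast hr
  have g1 : 0 < Real.Gamma ((r : ℝ) - σ) := Real.Gamma_pos_of_pos (by linarith)
  have g2 : 0 < Real.Gamma (1 - σ) := Real.Gamma_pos_of_pos (by linarith)
  have g3 : 0 < Real.Gamma (c + 1) := Real.Gamma_pos_of_pos (by linarith)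
  have g4 : 0 < Real.Gamma (c + σ) := Real.Gamma_pos_of_pos (by linarith)
  have hξ : 0 < ξ := by positivity
  have hsq : ∀ M : ℕ, ((M : ℝ) ^ (σ / 2)) ^ 2 = (M : ℝ) ^ σ := fun M => by
    rw [← Real.rpow_natCast, ← Real.rpow_mul (Nat.cast_nonneg M)]
    norm_num
  set R : ℕ → ℝ := fun M : ℕ => (M.descFactorial r : ℝ) *
      (Real.Gamma (M + (c + N) + σ - r) / Real.Gamma (M + (c + N))) / (M : ℝ) ^ σ with hR
  have hRn : NearOne R := nearOne_ratio (c + N) σ hσ0 hσ1 r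
  have hLR : ∀ᶠ M : ℕ in atTop, α * (M.choose r : ℝ) *
                  (Real.Gamma ((r : ℝ) - σ) * Real.Gamma (c + σ + N + M - r) *
                    Real.Gamma (c + 1)) /
                (Real.Gamma (1 - σ) * Real.Gamma (c + σ) * Real.Gamma (c + N + M))
      = ξ * R M * (M : ℝ) ^ σ := by
    filter_upwards [eventually_gt_atTop 0] with M hM
    have hM' : (M : ℝ) ^ σ ≠ 0 := by positivity
    have e1 : c + σ + N + M - r = M + (c + N) + σ - r := by ring
    have e2 : c + N + M = M + (c + N) := by ring
    rw [hR, hξdef, e1, e2]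
    simp only [Nat.descFactorial_eq_factorial_mul_choose, Nat.cast_mul]
    have hf : (r.factorial : ℝ) ≠ 0 := by positivity
    field_simp
  refine poisson_clt ξ hξ.le _ (fun M : ℕ => (M : ℝ) ^ (σ / 2)) ?_ ?_ ?_ μ
    ((eventually_ge_atTop r).mono fun M hM => by simpa only [hsq] using hμ M hM) ν hν
  · filter_upwards [hLR, hRn.tendsto.eventually (lt_mem_nhds zero_lt_one)] with M h1 h2
    rw [h1]
    positivity
  · exact (tendsto_rpow_atTop (by linarith)).comp tendsto_natCast_atTop_atTop
  · have hO : (fun M : ℕ => ξ * (M : ℝ) ^ (σ / 2) * (R M - 1)) =O[atTop]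
        (fun M : ℕ => (M : ℝ) ^ (σ / 2) * ((M : ℝ))⁻¹) :=
      (Asymptotics.isBigO_const_mul_self ξ _ _).mul hRn
    have h0 : Tendsto (fun M : ℕ => (M : ℝ) ^ (σ / 2) * ((M : ℝ))⁻¹) atTop (nhds 0) := by
      have h1 := (tendsto_rpow_neg_atTop (by linarith : 0 < 1 - σ / 2)).comp
        (tendsto_natCast_atTop_atTop (R := ℝ))
      refine h1.congr' ?_
      filter_upwards [eventually_gt_atTop 0] with M hM
      have hM' : (0 : ℝ) < M := by positivity
      simp only [Function.comp_apply]
      rw [neg_sub, Real.rpow_sub_one hM'.ne', div_eq_mul_inv]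
    refine (hO.trans_tendsto h0).congr' ?_
    filter_upwards [hLR, eventually_gt_atTop 0] with M h1 hM
    have hM' : (0 : ℝ) < (M : ℝ) ^ (σ / 2) := by positivity
    rw [h1, ← hsq M]
    field_simp
end

section
/- Let N ≥ 1, J ≥ 0, and 1 ≤ p < N be integers, and let X be an N × J binary matrix (X_{n,j} ∈ {0,1}) such that every column contains at least one entry equal to 1. For a subset I of the row index set of size p, let V(I) be the number of columns j for which X_{n,j} = 1 for some row n not in I, and for 1 ≤ ℓ ≤ N let f_ℓ be the number of columns whose entries sum to exactly ℓ. Then Σ_{I : |I| = p} (J − V(I)) = Σ_{ℓ=1}^{p} binom(N−ℓ, p−ℓ) f_ℓ. Equivalently, the average over all p-subsets I of the number of species in the full sample missed when the rows in I are deleted satisfies binom(N,p)^{-1} Σ_{|I|=p} V(I) = J − binom(N,p)^{-1} Σ_{ℓ=1}^{p} binom(N−ℓ, p−ℓ) f_ℓ. -/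
open Finset

theorem count_supersets {N : ℕ} (p : ℕ) (S : Finset (Fin N)) (h : S.card ≤ p) :
    ((Finset.powersetCard p (Finset.univ : Finset (Fin N))).filter (fun I => S ⊆ I)).card
      = (N - S.card).choose (p - S.card) := by
  have h1 : (N - S.card).choose (p - S.card) = (Finset.powersetCard (p - S.card) Sᶜ).card := by
    rw [Finset.card_powersetCard, Finset.card_compl, Fintype.card_fin]
  rw [h1]
  refine Finset.card_bij' (fun I _ => I \ S) (fun T _ => T ∪ S) ?_ ?_ ?_ ?_
  · intro I hI
    simp only [Finset.mem_filter, Finset.mem_powersetCard_univ] at hI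
    rw [Finset.mem_powersetCard]
    refine ⟨?_, ?_⟩
    · intro x hx
      simp only [Finset.mem_sdiff] at hx
      simp [hx.2]
    · rw [Finset.card_sdiff_of_subset hI.2, hI.1]
  · intro T hT
    rw [Finset.mem_powersetCard] at hT
    simp only [Finset.mem_filter, Finset.mem_powersetCard_univ]
    refine ⟨?_, Finset.subset_union_right⟩
    rw [Finset.card_union_of_disjoint, hT.2]
    · omega
    · exact Finset.disjoint_left.2 (fun x hx hS => by simpa [hS] using hT.1 hx)
  · intro I hI
    simp only [Finset.mem_filter] at hI
    exact Finset.sdiff_union_of_subset hI.2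
  · intro T hT
    rw [Finset.mem_powersetCard] at hT
    ext x
    have := @hT.1 x
    simp only [Finset.mem_compl] at this
    simp only [Finset.mem_sdiff, Finset.mem_union]
    tauto

/-- Leave-`p`-out counting identity for the jackknife.  For an `N × J`
binary matrix `X` whose columns are all nonzero, with `V(I)` the number of columns seen in
some row outside `I` and `f ℓ` the number of columns with column sum exactly `ℓ`,
`∑_{|I|=p} (J − V(I)) = ∑_{ℓ=1}^{p} C(N−ℓ, p−ℓ) f_ℓ`; equivalently
`C(N,p)⁻¹ ∑_{|I|=p} V(I) = J − C(N,p)⁻¹ ∑_{ℓ=1}^{p} C(N−ℓ, p−ℓ) f_ℓ`. -/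
theorem stmt19 (N J p : ℕ) (hN : 1 ≤ N) (hp1 : 1 ≤ p) (hpN : p < N)
    (X : Fin N → Fin J → ℕ)
    (hbin : ∀ n j, X n j = 0 ∨ X n j = 1)
    (hcol : ∀ j, ∃ n, X n j = 1) :
    (∑ I ∈ Finset.powersetCard p (Finset.univ : Finset (Fin N)),
        (J - (Finset.univ.filter (fun j : Fin J => ∃ n, n ∉ I ∧ X n j = 1)).card))
      = ∑ ℓ ∈ Finset.Icc 1 p,
          (N - ℓ).choose (p - ℓ) *
            (Finset.univ.filter (fun j : Fin J => ∑ n, X n j = ℓ)).card ∧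
    ((N.choose p : ℝ))⁻¹ *
        ∑ I ∈ Finset.powersetCard p (Finset.univ : Finset (Fin N)),
          (((Finset.univ.filter (fun j : Fin J => ∃ n, n ∉ I ∧ X n j = 1)).card : ℕ) : ℝ)
      = (J : ℝ) - ((N.choose p : ℝ))⁻¹ *
          ∑ ℓ ∈ Finset.Icc 1 p,
            (((N - ℓ).choose (p - ℓ) : ℕ) : ℝ) *
              (((Finset.univ.filter (fun j : Fin J => ∑ n, X n j = ℓ)).card : ℕ) : ℝ) := by
  classical
  have hsum : ∀ j, ∑ n, X n j = (Finset.univ.filter (fun n => X n j = 1)).card := by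
    intro j
    rw [Finset.card_filter]
    refine Finset.sum_congr rfl fun n _ => ?_
    rcases hbin n j with h | h <;> simp [h]
  have hV : ∀ I : Finset (Fin N),
      J = (Finset.univ.filter (fun j : Fin J => ∃ n, n ∉ I ∧ X n j = 1)).card +
        (Finset.univ.filter (fun j : Fin J => (Finset.univ.filter (fun n => X n j = 1)) ⊆ I)).card := by
    intro I
    have h := Finset.card_filter_add_card_filter_not (s := (Finset.univ : Finset (Fin J)))
      (fun j : Fin J => ∃ n, n ∉ I ∧ X n j = 1)
    rw [Finset.card_univ, Fintype.card_fin] at h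
    refine h.symm.trans ?_
    congr 2
    ext j
    simp only [Finset.mem_filter, Finset.mem_univ, true_and, Finset.subset_iff]
    constructor
    · intro h n hn
      by_contra hI
      exact h ⟨n, hI, hn⟩
    · rintro h ⟨n, hI, hn⟩
      exact hI (h hn)
  have key : (∑ I ∈ Finset.powersetCard p (Finset.univ : Finset (Fin N)),
      (Finset.univ.filter (fun j : Fin J => (Finset.univ.filter (fun n => X n j = 1)) ⊆ I)).card)
      = ∑ ℓ ∈ Finset.Icc 1 p,
          (N - ℓ).choose (p - ℓ) *
            (Finset.univ.filter (fun j : Fin J => ∑ n, X n j = ℓ)).card := by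
    simp only [Finset.card_filter (fun j : Fin J => _), Finset.mul_sum]
    rw [Finset.sum_comm, Finset.sum_comm (s := Finset.Icc 1 p)]
    refine Finset.sum_congr rfl fun j _ => ?_
    rw [← Finset.card_filter, hsum j]
    obtain ⟨n, hn⟩ := hcol j
    have hpos : 1 ≤ (Finset.univ.filter (fun n => X n j = 1)).card :=
      Finset.card_pos.2 ⟨n, by simp [hn]⟩
    generalize (Finset.univ.filter (fun n => X n j = 1)) = S at hpos ⊢
    simp only [mul_ite, mul_one, mul_zero, Finset.sum_ite_eq, Finset.mem_Icc]
    split_ifs with h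
    · exact count_supersets p S h.2
    · rw [Finset.card_eq_zero, Finset.filter_eq_empty_iff]
      intro I hI hS
      rw [Finset.mem_powersetCard_univ] at hI
      have := Finset.card_le_card hS
      omega
  refine ⟨?_, ?_⟩
  · rw [← key]
    refine Finset.sum_congr rfl fun I _ => ?_
    have := hV I
    omega
  · have hc : (N.choose p : ℝ) ≠ 0 := by
      exact_mod_cast (Nat.choose_pos hpN.le).ne'
    have htot : N.choose p * J
        = (∑ I ∈ Finset.powersetCard p (Finset.univ : Finset (Fin N)),
          (Finset.univ.filter (fun j : Fin J => ∃ n, n ∉ I ∧ X n j = 1)).card)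
        + ∑ ℓ ∈ Finset.Icc 1 p,
          (N - ℓ).choose (p - ℓ) *
            (Finset.univ.filter (fun j : Fin J => ∑ n, X n j = ℓ)).card := by
      rw [← key, ← Finset.sum_add_distrib, ← Finset.sum_congr rfl (fun I _ => hV I)]
      simp
    have htot' := congrArg (Nat.cast : ℕ → ℝ) htot
    simp only [Nat.cast_add, Nat.cast_mul, Nat.cast_sum] at htot'
    rw [eq_sub_iff_add_eq, ← mul_add, ← htot', inv_mul_cancel_left₀ hc]
end
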